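/- arXiv:1908.05225 — 2 statements merged into one kernel-verified Lean document; each statement's English description precedes it below -/
import Mathlib

section
/- Let G = (V, E) be a finite τ-critical simple graph of order n = |V| with transversal number τ(G) = t. Then the degree of every vertex x ∈ V satisfies deg_G(x) ≤ 2t − n + 1. -/
open SimpleGraph

/-- A transversal set (vertex cover): a set of vertices meeting every edge. -/
def IsTransversal {V : Type*} (G : SimpleGraph V) (S : Set V) : Prop :=
  ∀ ⦃u v : V⦄, G.Adj u v → u ∈ S ∨ v ∈ S

/-- The transversal number: minimum cardinality of a transversal set. -/
noncomputable def tau {V : Type*} [Fintype V] (G : SimpleGraph V) : ℕ :=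
  sInf {n | ∃ S : Finset V, IsTransversal G ↑S ∧ S.card = n}

/-- A graph with no isolated vertices is τ-critical if deleting any edge
decreases the transversal number by one. -/
def TauCritical {V : Type*} [Fintype V] (G : SimpleGraph V) : Prop :=
  (∀ v : V, ∃ u, G.Adj v u) ∧
  ∀ e ∈ G.edgeSet, tau (G.deleteEdges {e}) = tau G - 1

theorem IsTransversal.tau_le {V : Type*} [Fintype V] {G : SimpleGraph V} {S : Finset V}
    (hS : IsTransversal G ↑S) : tau G ≤ S.card :=
  Nat.sInf_le ⟨S, hS, rfl⟩

theorem exists_isTransversal_card_eq_tau {V : Type*} [Fintype V] (G : SimpleGraph V) :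
    ∃ S : Finset V, IsTransversal G ↑S ∧ S.card = tau G :=
  Nat.sInf_mem (s := {n | ∃ S : Finset V, IsTransversal G ↑S ∧ S.card = n})
    ⟨_, Finset.univ, fun _ _ _ => by simp, rfl⟩

theorem SimpleGraph.IsIndepSet.card_add_tau_le {V : Type*} [Fintype V] [DecidableEq V]
    {G : SimpleGraph V} {A : Finset V} (hA : G.IsIndepSet ↑A) :
    A.card + tau G ≤ Fintype.card V := by
  have h : IsTransversal G ↑Aᶜ := by
    intro u v huv
    by_contra! h
    simp only [Finset.coe_compl, Set.mem_compl_iff, not_not] at h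
    exact hA h.1 h.2 huv.ne huv
  have := h.tau_le
  have := A.card_add_card_compl
  omega

/-- In a τ-critical graph, every edge is the only edge spanned by some set with one more vertex
than a maximum independent set. -/
theorem TauCritical.exists_unique_edge {V : Type*} [Fintype V] [DecidableEq V]
    {G : SimpleGraph V} (hG : TauCritical G) {a b : V} (hab : G.Adj a b) :
    ∃ T : Finset V, a ∈ T ∧ b ∈ T ∧ T.card + tau G = Fintype.card V + 1 ∧
      ∀ u ∈ T, ∀ v ∈ T, G.Adj u v → s(u, v) = s(a, b) := by
  obtain ⟨S, hS, hcard⟩ := exists_isTransversal_card_eq_tau (G.deleteEdges {s(a, b)})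
  rw [hG.2 _ hab] at hcard
  have hpos : 0 < tau G := by
    obtain ⟨S', hS', h'⟩ := exists_isTransversal_card_eq_tau G
    rw [← h', Finset.card_pos]
    rcases hS' hab with h | h <;> exact ⟨_, h⟩
  have hedge : ∀ u v, u ∉ S → v ∉ S → G.Adj u v → s(u, v) = s(a, b) := by
    intro u v hu hv huv
    by_contra hne
    rcases hS ((G.deleteEdges_adj).2 ⟨huv, hne⟩) with h | h
    · exact hu h
    · exact hv h
  have hout : a ∉ S ∧ b ∉ S := by
    by_contra hin
    have : IsTransversal G ↑S := by
      intro u v huv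
      by_contra! h
      have := hedge u v h.1 h.2 huv
      rcases Sym2.eq_iff.1 this with ⟨rfl, rfl⟩ | ⟨rfl, rfl⟩
      · exact hin h
      · exact hin h.symm
    have := this.tau_le
    omega
  refine ⟨Sᶜ, by simpa using hout.1, by simpa using hout.2, ?_, ?_⟩
  · have := S.card_add_card_compl
    omega
  · simpa using fun u hu v hv => hedge u v hu hv

/-- An independent set in a τ-critical graph has at least as many neighbours as elements. -/
theorem TauCritical.card_le_card_biUnion_neighborFinset {V : Type*} [Fintype V] [DecidableEq V]
    {G : SimpleGraph V} [DecidableRel G.Adj] (hG : TauCritical G) (A : Finset V)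
    (hA : G.IsIndepSet ↑A) : A.card ≤ (A.biUnion fun v => G.neighborFinset v).card := by
  induction A using Finset.strongInduction with
  | H A ih =>
    by_contra! hlt
    obtain ⟨a, ha⟩ : A.Nonempty := Finset.card_pos.1 (by omega)
    obtain ⟨b, hab⟩ := hG.1 a
    obtain ⟨T, haT, hbT, hT, hedge⟩ := hG.exists_unique_edge hab
    set N := A.biUnion fun v => G.neighborFinset v
    have hbN : b ∈ N := Finset.mem_biUnion.2 ⟨a, ha, by simpa using hab⟩
    have hss : (A ∩ T).erase a ⊂ A :=
      (Finset.erase_ssubset (by simp [ha, haT])).trans_subset Finset.inter_subset_left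
    have hB := ih _ hss (hA.mono (by exact_mod_cast hss.subset))
    have hsub : (((A ∩ T).erase a).biUnion fun v => G.neighborFinset v) ⊆ N \ T := by
      intro w hw
      simp only [Finset.mem_biUnion, Finset.mem_erase, Finset.mem_inter, mem_neighborFinset] at hw
      obtain ⟨u, ⟨hua, huA, huT⟩, huw⟩ := hw
      refine Finset.mem_sdiff.2 ⟨Finset.mem_biUnion.2 ⟨u, huA, by simpa using huw⟩, fun hwT => ?_⟩
      rcases Sym2.eq_iff.1 (hedge u huT w hwT huw) with ⟨h, -⟩ | ⟨h, -⟩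
      · exact hua h
      · exact hA ha huA (Ne.symm hua) (h ▸ hab)
    have hBN := Finset.card_le_card hsub
    have hind : G.IsIndepSet ↑((T \ N) ∪ A) := by
      have hAN : ∀ u ∈ A, ∀ v, G.Adj u v → v ∈ N := fun u hu v huv =>
        Finset.mem_biUnion.2 ⟨u, hu, by simpa using huv⟩
      intro u hu v hv hne huv
      simp only [Finset.coe_union, Finset.coe_sdiff, Set.mem_union, Set.mem_sdiff,
        Finset.mem_coe] at hu hv
      rcases hu with hu | hu <;> rcases hv with hv | hv
      · rcases Sym2.eq_iff.1 (hedge u hu.1 v hv.1 huv) with ⟨-, rfl⟩ | ⟨rfl, -⟩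
        · exact hv.2 hbN
        · exact hu.2 hbN
      · exact hu.2 (hAN v hv u huv.symm)
      · exact hv.2 (hAN u hu v huv)
      · exact hA hu hv hne huv
    have hle := hind.card_add_tau_le
    have hcard : (T \ N ∪ A \ T).card ≤ (T \ N ∪ A).card :=
      Finset.card_le_card (Finset.union_subset_union_right Finset.sdiff_subset)
    rw [Finset.card_union_of_disjoint (Finset.disjoint_sdiff.mono_left Finset.sdiff_subset)]
      at hcard
    have h₁ := Finset.card_sdiff_add_card_inter T N
    have h₂ := Finset.card_sdiff_add_card_inter N T
    have h₃ := Finset.card_sdiff_add_card_inter A T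
    have h₄ := Finset.card_erase_add_one (show a ∈ A ∩ T by simp [ha, haT])
    rw [Finset.inter_comm N T] at h₂
    omega

/-- Hajnal's inequality: the union and the intersection of a nonempty family of maximum
independent sets together have at least twice the size of a maximum independent set. -/
theorem SimpleGraph.two_mul_le_card_biUnion_add_card_inf {V ι : Type*} [Fintype V]
    [DecidableEq V] {G : SimpleGraph V} {α : ℕ}
    (hα : ∀ A : Finset V, G.IsIndepSet ↑A → A.card ≤ α) (f : ι → Finset V) {s : Finset ι}
    (hs : s.Nonempty) (hind : ∀ i ∈ s, G.IsIndepSet ↑(f i)) (hcard : ∀ i ∈ s, (f i).card = α) :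
    2 * α ≤ (s.biUnion f).card + (s.inf f).card := by
  classical
  induction hs using Finset.Nonempty.cons_induction with
  | singleton i =>
    have := hcard i (by simp)
    simp [this, two_mul]
  | cons i s hi hs ih =>
    have ih := ih (fun j hj => hind j (by simp [hj])) (fun j hj => hcard j (by simp [hj]))
    rw [Finset.cons_eq_insert, Finset.biUnion_insert, Finset.inf_insert]
    have hi' := hcard i (by simp)
    set U := s.biUnion f
    set I := s.inf f
    have hIU : ∀ u ∈ I, ∀ v ∈ U, u ≠ v → ¬ G.Adj u v := by
      intro u hu v hv
      obtain ⟨j, hj, hvj⟩ := Finset.mem_biUnion.1 hv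
      exact hind j (by simp [hj]) (Finset.inf_le (f := f) hj hu) hvj
    have hsub : I ⊆ U := by
      obtain ⟨j, hj⟩ := hs
      exact (Finset.inf_le (f := f) hj).trans (Finset.subset_biUnion_of_mem f hj)
    have hmix : G.IsIndepSet ↑((f i ∩ U) ∪ (I \ f i)) := by
      intro u hu v hv hne
      simp only [Finset.coe_union, Finset.coe_sdiff, Finset.coe_inter, Set.mem_union,
        Set.mem_sdiff, Set.mem_inter_iff, Finset.mem_coe] at hu hv
      rcases hu with hu | hu <;> rcases hv with hv | hv
      · exact hind i (by simp) hu.1 hv.1 hne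
      · exact fun h => hIU v hv.1 u hu.2 hne.symm h.symm
      · exact hIU u hu.1 v hv.2 hne
      · exact hIU u hu.1 v (hsub hv.1) hne
    have hle := hα _ hmix
    rw [Finset.card_union_of_disjoint
      (Finset.disjoint_sdiff.mono_left Finset.inter_subset_left)] at hle
    have h₁ := Finset.card_union_add_card_inter (f i) U
    have h₂ := Finset.card_sdiff_add_card_inter I (f i)
    rw [Finset.inf_eq_inter, Finset.inter_comm (f i) I]
    omega

theorem hajnal_degree_bound {V : Type*} [Fintype V] [DecidableEq V]
    (G : SimpleGraph V) [DecidableRel G.Adj] (n t : ℕ)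
    (hcrit : TauCritical G) (hn : Fintype.card V = n) (ht : tau G = t) :
    ∀ x : V, (G.degree x : ℤ) ≤ 2 * t - n + 1 := by
  intro x
  choose! T hxT hyT hcard hedge using fun y (hy : G.Adj x y) => hcrit.exists_unique_edge hy
  have htn : t ≤ n := by
    have := (show IsTransversal G ↑(Finset.univ : Finset V) from fun _ _ _ => by simp).tau_le
    rw [Finset.card_univ] at this
    omega
  have hind : ∀ y ∈ G.neighborFinset x, G.IsIndepSet ↑((T y).erase y) := by
    intro y hy u hu v hv _ huv
    rw [mem_neighborFinset] at hy
    simp only [Finset.coe_erase, Set.mem_sdiff, Finset.mem_coe, Set.mem_singleton_iff] at hu hv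
    rcases Sym2.eq_iff.1 (hedge y hy u hu.1 v hv.1 huv) with h | h
    · exact hv.2 h.2
    · exact hu.2 h.1
  have hne : (G.neighborFinset x).Nonempty := by
    obtain ⟨y, hy⟩ := hcrit.1 x
    exact ⟨y, by simpa using hy⟩
  have key := two_mul_le_card_biUnion_add_card_inf (G := G) (α := n - t)
    (fun A hA => by have := hA.card_add_tau_le; omega) (fun y => (T y).erase y) hne hind
    (fun y hy => by
      rw [mem_neighborFinset] at hy
      have := hcard y hy
      rw [Finset.card_erase_of_mem (hyT y hy)]
      omega)
  set U := (G.neighborFinset x).biUnion fun y => (T y).erase y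
  set I := (G.neighborFinset x).inf fun y => (T y).erase y with hI
  have hmemI : ∀ u ∈ I, ∀ y, G.Adj x y → u ≠ y ∧ u ∈ T y := fun u hu y hy =>
    Finset.mem_erase.1 (Finset.inf_le (f := fun y => (T y).erase y)
      ((mem_neighborFinset _ _ _).2 hy) hu)
  have hIind : G.IsIndepSet ↑I := by
    obtain ⟨y, hy⟩ := hne
    exact (hind y hy).mono (by exact_mod_cast Finset.inf_le (f := fun y => (T y).erase y) hy)
  have hxI : x ∈ I := by
    rw [hI, Finset.mem_inf]
    intro y hy
    rw [mem_neighborFinset] at hy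
    exact Finset.mem_erase.2 ⟨hy.ne, hxT y hy⟩
  have hN := hcrit.card_le_card_biUnion_neighborFinset (I.erase x)
    (hIind.mono (by exact_mod_cast Finset.erase_subset x I))
  set N := (I.erase x).biUnion fun v => G.neighborFinset v
  have hdisj : Disjoint (G.neighborFinset x) N := by
    rw [Finset.disjoint_left]
    intro y hy hyN
    rw [mem_neighborFinset] at hy
    obtain ⟨u, hu, huy⟩ := Finset.mem_biUnion.1 hyN
    rw [mem_neighborFinset] at huy
    obtain ⟨hux, huI⟩ := Finset.mem_erase.1 hu
    have := hmemI u huI y hy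
    rcases Sym2.eq_iff.1 (hedge y hy u this.2 y (hyT y hy) huy) with h | h
    · exact hux h.1
    · exact this.1 h.1
  have hdisjU : Disjoint U (G.neighborFinset x ∪ N) := by
    rw [Finset.disjoint_left]
    intro v hv hvN
    obtain ⟨u, huI, huv⟩ : ∃ u ∈ I, G.Adj u v := by
      rcases Finset.mem_union.1 hvN with h | h
      · exact ⟨x, hxI, by simpa using h⟩
      · obtain ⟨u, hu, huv⟩ := Finset.mem_biUnion.1 h
        exact ⟨u, Finset.mem_of_mem_erase hu, by simpa using huv⟩
    obtain ⟨y, hy, hvy⟩ := Finset.mem_biUnion.1 hv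
    exact hind y hy (Finset.inf_le (f := fun y => (T y).erase y) hy huI) hvy huv.ne huv
  have htotal := Finset.card_le_univ (U ∪ (G.neighborFinset x ∪ N))
  rw [Finset.card_union_of_disjoint hdisjU, Finset.card_union_of_disjoint hdisj,
    card_neighborFinset_eq_degree] at htotal
  have := Finset.card_erase_add_one hxI
  omega
end

section
/- Let G = (V, E) be a finite τ-critical simple graph of order n = |V| with transversal number τ(G) = t. If |V| + |E| = (t+2 choose 2), then G is regular of degree 2t − n + 1, and either n = t + 1 or n = t + 2. -/
open SimpleGraph

section TauCriticalGraphs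

variable {V : Type*} [Fintype V] {G : SimpleGraph V}

theorem tau_le_card {S : Finset V} (hS : IsTransversal G (S : Set V)) : tau G ≤ S.card :=
  Nat.sInf_le ⟨S, hS, rfl⟩

theorem exists_transversal_card_eq_tau (G : SimpleGraph V) :
    ∃ S : Finset V, IsTransversal G (S : Set V) ∧ S.card = tau G :=
  Nat.sInf_mem (s := {n | ∃ S : Finset V, IsTransversal G (S : Set V) ∧ S.card = n})
    ⟨_, Finset.univ, fun _ _ _ => by simp, rfl⟩

/-- The set of vertices with at least one neighbor in `Y`. -/
def neighborUnion (G : SimpleGraph V) [DecidableRel G.Adj] (Y : Finset V) : Finset V :=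
  {x | ∃ y ∈ Y, G.Adj y x}

theorem mem_neighborUnion [DecidableRel G.Adj] {Y : Finset V} {x : V} :
    x ∈ neighborUnion G Y ↔ ∃ y ∈ Y, G.Adj y x := by
  simp [neighborUnion]

theorem neighborUnion_mono [DecidableRel G.Adj] {Y Z : Finset V} (h : Z ⊆ Y) :
    neighborUnion G Z ⊆ neighborUnion G Y := fun x hx => by
  obtain ⟨z, hz, hzx⟩ := mem_neighborUnion.1 hx
  exact mem_neighborUnion.2 ⟨z, h hz, hzx⟩

variable [DecidableEq V]

theorem card_add_tau_le {S : Finset V} (hS : ∀ x ∈ S, ∀ y ∈ S, ¬ G.Adj x y) :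
    S.card + tau G ≤ Fintype.card V := by
  have h : tau G ≤ Sᶜ.card := tau_le_card (G := G) fun x y hxy => by
    by_contra! h
    simp only [Finset.coe_compl, Set.mem_compl_iff, Finset.mem_coe, not_not] at h
    exact hS x h.1 y h.2 hxy
  have := S.card_add_card_compl
  omega

/-- Each edge of a τ-critical graph is the only edge inside some set with one vertex more than
a maximum independent set. -/
theorem TauCritical.exists_finset_unique_edge (hG : TauCritical G) {a b : V} (hab : G.Adj a b) :
    ∃ S : Finset V, a ∈ S ∧ b ∈ S ∧ (∀ x ∈ S, ∀ y ∈ S, G.Adj x y → s(x, y) = s(a, b)) ∧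
      S.card + tau G = Fintype.card V + 1 := by
  obtain ⟨T, hT, hTc⟩ := exists_transversal_card_eq_tau (G.deleteEdges {s(a, b)})
  rw [hG.2 _ hab] at hTc
  have hpos : 0 < tau G := by
    obtain ⟨R, hR, hRc⟩ := exists_transversal_card_eq_tau G
    rw [← hRc, Finset.card_pos]
    rcases hR hab with h | h
    exacts [⟨a, h⟩, ⟨b, h⟩]
  have key : ∀ x ∉ T, ∀ y ∉ T, G.Adj x y → s(x, y) = s(a, b) := by
    intro x hx y hy hxy
    by_contra hne
    have := hT (u := x) (v := y) (by simpa [SimpleGraph.deleteEdges_adj, hxy] using hne)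
    simp_all
  have hnot : a ∉ T ∧ b ∉ T := by
    by_contra hcon
    have : tau G ≤ T.card := tau_le_card (G := G) fun x y hxy => by
      by_contra! h
      have := key x h.1 y h.2 hxy
      simp only [Finset.mem_coe] at h
      rw [Sym2.eq_iff] at this
      rcases this with ⟨rfl, rfl⟩ | ⟨rfl, rfl⟩
      · exact hcon h
      · exact hcon h.symm
    omega
  refine ⟨Tᶜ, by simpa using hnot.1, by simpa using hnot.2, ?_, ?_⟩
  · simpa using key
  · have := T.card_add_card_compl
    omega

variable [DecidableRel G.Adj]

theorem card_sdiff_lt_card_inter_neighborUnion {Y S : Finset V} {a b : V}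
    (hY : ∀ x ∈ Y, ∀ y ∈ Y, ¬ G.Adj x y)
    (hS : ∀ x ∈ S, ∀ y ∈ S, G.Adj x y → s(x, y) = s(a, b))
    (hSc : S.card + tau G = Fintype.card V + 1) (hb : b ∈ neighborUnion G Y) :
    (Y \ S).card < (S ∩ neighborUnion G Y).card := by
  set N := neighborUnion G Y
  have hmem : ∀ x, x ∈ N ↔ ∃ y ∈ Y, G.Adj y x := fun _ => mem_neighborUnion
  have hind : ∀ x ∈ (S \ N) ∪ (Y \ S), ∀ y ∈ (S \ N) ∪ (Y \ S), ¬ G.Adj x y := by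
    intro x hx y hy hxy
    simp only [Finset.mem_union, Finset.mem_sdiff] at hx hy
    rcases hx with hx | hx <;> rcases hy with hy | hy
    · have := hS x hx.1 y hy.1 hxy
      rw [Sym2.eq_iff] at this
      rcases this with ⟨rfl, rfl⟩ | ⟨rfl, rfl⟩
      · exact hy.2 hb
      · exact hx.2 hb
    · exact hx.2 ((hmem x).2 ⟨y, hy.1, hxy.symm⟩)
    · exact hy.2 ((hmem y).2 ⟨x, hx.1, hxy⟩)
    · exact hY x hx.1 y hy.1 hxy
  have h1 := card_add_tau_le hind
  have hdisj : Disjoint (S \ N) (Y \ S) :=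
    Finset.disjoint_left.2 fun x hx hx' => (Finset.mem_sdiff.1 hx').2 (Finset.mem_sdiff.1 hx).1
  rw [Finset.card_union_of_disjoint hdisj] at h1
  have h2 := Finset.card_sdiff_add_card_inter S N
  omega

/-- If `v` and `Y` form an independent set of a τ-critical graph, then `Y` has at least `|Y|`
neighbors that are not neighbors of `v`. -/
theorem TauCritical.card_le_card_neighborUnion_sdiff (hG : TauCritical G) (v : V)
    (Y : Finset V) (hvY : v ∉ Y) (hind : ∀ y ∈ Y, ¬ G.Adj v y)
    (hY : ∀ x ∈ Y, ∀ y ∈ Y, ¬ G.Adj x y) :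
    Y.card ≤ (neighborUnion G Y \ G.neighborFinset v).card := by
  induction Y using Finset.strongInduction with
  | H Y ih =>
  by_contra! hlt
  have hsub : ∀ Z ⊂ Y, ((neighborUnion G Y \ G.neighborFinset v) \
      (neighborUnion G Z \ G.neighborFinset v)).card + Z.card < Y.card := by
    intro Z hZ
    have h1 := ih Z hZ (fun h => hvY (hZ.1 h)) (fun y hy => hind y (hZ.1 hy))
      (fun x hx y hy => hY x (hZ.1 hx) y (hZ.1 hy))
    have h2 := Finset.card_sdiff_add_card_eq_card (Finset.sdiff_subset_sdiff
      (neighborUnion_mono (G := G) hZ.1)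
      (Finset.Subset.refl (G.neighborFinset v)))
    omega
  by_cases hdisj : Disjoint (neighborUnion G Y) (G.neighborFinset v)
  · obtain ⟨y, hy⟩ : Y.Nonempty := Finset.card_pos.1 (by omega)
    obtain ⟨x, hyx⟩ := hG.1 y
    obtain ⟨S, hyS, hxS, hS, hSc⟩ := hG.exists_finset_unique_edge hyx
    have h1 := card_sdiff_lt_card_inter_neighborUnion hY hS hSc
      (mem_neighborUnion.2 ⟨y, hy, hyx⟩)
    have hss : (Y ∩ S).erase y ⊂ Y := by
      refine ⟨fun z hz => by simp at hz; exact hz.2.1, fun h => ?_⟩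
      simpa using h hy
    have h2 := hsub _ hss
    have h3 : S ∩ neighborUnion G Y ⊆ (neighborUnion G Y \ G.neighborFinset v) \
        (neighborUnion G ((Y ∩ S).erase y) \ G.neighborFinset v) := by
      intro w hw
      rw [Finset.mem_inter] at hw
      simp only [Finset.mem_sdiff, not_and_or]
      refine ⟨⟨hw.2, Finset.disjoint_left.1 hdisj hw.2⟩, Or.inl fun h => ?_⟩
      simp only [mem_neighborUnion, Finset.mem_erase, Finset.mem_inter] at h
      obtain ⟨z, ⟨hzy, hzY, hzS⟩, hzw⟩ := h
      have := hS z hzS w hw.1 hzw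
      rw [Sym2.eq_iff] at this
      rcases this with ⟨rfl, rfl⟩ | ⟨rfl, rfl⟩
      · exact hzy rfl
      · exact hY _ hzY _ hy hzw
    have h4 := Finset.card_le_card h3
    have h5 := Finset.card_erase_add_one (Finset.mem_inter.2 ⟨hy, hyS⟩)
    have h6 := Finset.card_sdiff_add_card_inter Y S
    omega
  · obtain ⟨u, huY, huv⟩ := Finset.not_disjoint_iff.1 hdisj
    rw [SimpleGraph.mem_neighborFinset] at huv
    obtain ⟨S, hvS, huS, hS, hSc⟩ := hG.exists_finset_unique_edge huv
    have h1 := card_sdiff_lt_card_inter_neighborUnion hY hS hSc huY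
    have hss : Y ∩ S ⊂ Y := by
      refine ⟨Finset.inter_subset_left, fun h => ?_⟩
      obtain ⟨y, hy, hyu⟩ := mem_neighborUnion.1 huY
      have := hS y (Finset.mem_inter.1 (h hy)).2 u huS hyu
      rw [Sym2.eq_iff] at this
      rcases this with ⟨rfl, -⟩ | ⟨rfl, rfl⟩
      · exact hvY hy
      · exact G.loopless.irrefl _ hyu
    have h2 := hsub _ hss
    have h3 : S ∩ neighborUnion G Y ⊆
        insert u ((neighborUnion G Y \ G.neighborFinset v) \
          (neighborUnion G (Y ∩ S) \ G.neighborFinset v)) := by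
      intro w hw
      rw [Finset.mem_inter] at hw
      rw [Finset.mem_insert, or_iff_not_imp_left]
      intro hwu
      simp only [Finset.mem_sdiff, not_and_or]
      refine ⟨⟨hw.2, fun h => ?_⟩, Or.inl fun h => ?_⟩
      · rw [SimpleGraph.mem_neighborFinset] at h
        have := hS v hvS w hw.1 h
        rw [Sym2.congr_right] at this
        exact hwu this
      · simp only [mem_neighborUnion, Finset.mem_inter] at h
        obtain ⟨z, ⟨hzY, hzS⟩, hzw⟩ := h
        have := hS z hzS w hw.1 hzw
        rw [Sym2.eq_iff] at this
        rcases this with ⟨rfl, rfl⟩ | ⟨rfl, rfl⟩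
        · exact hwu rfl
        · exact hind _ hzY huv
    have h4 := (Finset.card_le_card h3).trans (Finset.card_insert_le _ _)
    have h6 := Finset.card_sdiff_add_card_inter Y S
    omega

/-- Hajnal's degree bound for τ-critical graphs. -/
theorem TauCritical.degree_add_card_le (hG : TauCritical G) (v : V) :
    G.degree v + Fintype.card V ≤ 2 * tau G + 1 := by
  obtain ⟨u, hvu⟩ := hG.1 v
  obtain ⟨S, hvS, huS, hS, hSc⟩ := hG.exists_finset_unique_edge hvu
  have hA : ∀ x ∈ S.erase u, ∀ y ∈ S.erase u, ¬ G.Adj x y := by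
    intro x hx y hy hxy
    rw [Finset.mem_erase] at hx hy
    have := hS x hx.2 y hy.2 hxy
    rw [Sym2.eq_iff] at this
    rcases this with ⟨-, h⟩ | ⟨h, -⟩
    · exact hy.1 h
    · exact hx.1 h
  have hvA : v ∈ S.erase u := Finset.mem_erase.2 ⟨hvu.ne, hvS⟩
  have hsub : (S.erase u).erase v ⊆ S.erase u := Finset.erase_subset _ _
  have h1 := hG.card_le_card_neighborUnion_sdiff v ((S.erase u).erase v) (by simp)
    (fun y hy => hA v hvA y (hsub hy)) (fun x hx y hy => hA x (hsub hx) y (hsub hy))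
  have h2 : neighborUnion G ((S.erase u).erase v) \ G.neighborFinset v ⊆
      (S.erase u)ᶜ \ G.neighborFinset v := by
    refine Finset.sdiff_subset_sdiff (fun w hw => ?_) (Finset.Subset.refl _)
    obtain ⟨z, hz, hzw⟩ := mem_neighborUnion.1 hw
    exact Finset.mem_compl.2 fun hw => hA z (hsub hz) w hw hzw
  have h3 : G.neighborFinset v ⊆ (S.erase u)ᶜ := fun w hw =>
    Finset.mem_compl.2 fun hw' => hA v hvA w hw' (by simpa using hw)
  have h4 := Finset.card_sdiff_add_card_eq_card h3
  have h5 := Finset.card_le_card h2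
  have h6 := (S.erase u).card_add_card_compl
  have h7 := Finset.card_erase_add_one hvA
  have h8 := Finset.card_erase_add_one huS
  rw [SimpleGraph.card_neighborFinset_eq_degree] at h4
  omega

end TauCriticalGraphs

theorem extremal_is_regular {V : Type*} [Fintype V] [DecidableEq V]
    (G : SimpleGraph V) [DecidableRel G.Adj] (n t : ℕ)
    (hcrit : TauCritical G) (hn : Fintype.card V = n) (ht : tau G = t)
    (heq : Fintype.card V + G.edgeFinset.card = (t + 2).choose 2) :
    (∀ x : V, (G.degree x : ℤ) = 2 * t - n + 1) ∧ (n = t + 1 ∨ n = t + 2) := by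
  have hdeg : ∀ x ∈ Finset.univ, (G.degree x : ℤ) ≤ 2 * t - n + 1 := fun x _ => by
    have := hcrit.degree_add_card_le x
    omega
  have hsum : (∑ x, (G.degree x : ℤ)) = 2 * G.edgeFinset.card := by
    exact_mod_cast G.sum_degrees_eq_twice_card_edges
  have hconst : (∑ _x : V, (2 * t - n + 1 : ℤ)) = n * (2 * t - n + 1) := by simp [hn]
  have hchoose : (2 * (n + G.edgeFinset.card) : ℤ) = (t + 1) * (t + 2) := by
    have h' : (t + 2).choose 2 * 2 = (t + 2) * (t + 1) := by
      rw [Nat.choose_two_right]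
      exact Nat.div_mul_cancel (Nat.even_mul_pred_self (t + 2)).two_dvd
    rw [← heq, hn] at h'
    zify at h'
    linarith
  have hle := Finset.sum_le_sum hdeg
  have hprod : ((n : ℤ) - t - 1) * (n - t - 2) ≤ 0 := by nlinarith
  have hcases : n = t + 1 ∨ n = t + 2 := by
    by_contra! h
    rcases lt_or_gt_of_ne h.1 with h1 | h1
    · nlinarith [show (n : ℤ) + 1 ≤ t + 1 by exact_mod_cast h1]
    · nlinarith [show (t : ℤ) + 3 ≤ n by omega]
  refine ⟨fun x => (Finset.sum_eq_sum_iff_of_le hdeg).1 ?_ x (Finset.mem_univ x), hcases⟩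
  rw [hsum, hconst]
  rcases hcases with rfl | rfl <;> push_cast at hchoose ⊢ <;> linarith
end
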